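/- Let n ≥ 5, let α ∈ [2, n−3], and let E ⊂ ℝⁿ be a set of finite perimeter with |E| = |B_1|. Set f_E = χ_{B_1} − χ_E and, for β ∈ (0,n), φ_β(r) = (1/H^{n−1}(∂B_r)) ∫_{∂B_r} I_β f_E dH^{n−1}. If φ_α is nonincreasing on (0,∞), then φ_{α+2} is nonincreasing on (0,∞). -/

import Mathlib

open MeasureTheory Metric Set

noncomputable section

/-- The divergence of a vector field on `ℝⁿ`. -/
def vdiv {n : ℕ} (φ : EuclideanSpace ℝ (Fin n) → EuclideanSpace ℝ (Fin n))
    (x : EuclideanSpace ℝ (Fin n)) : ℝ :=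
  ∑ i, fderiv ℝ φ x (EuclideanSpace.single i 1) i

/-- The set of admissible values `∫_F div φ` in the variational definition of the
perimeter: `φ` ranges over compactly supported `C¹` vector fields with `‖φ‖ ≤ 1`. -/
def perimVals {n : ℕ} (F : Set (EuclideanSpace ℝ (Fin n))) : Set ℝ :=
  { r | ∃ φ : EuclideanSpace ℝ (Fin n) → EuclideanSpace ℝ (Fin n),
      ContDiff ℝ 1 φ ∧ HasCompactSupport φ ∧ (∀ x, ‖φ x‖ ≤ 1) ∧
      r = ∫ x in F, vdiv φ x }

/-- The (distributional) perimeter `P(F)`. -/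
def perimeter {n : ℕ} (F : Set (EuclideanSpace ℝ (Fin n))) : ℝ := sSup (perimVals F)

/-- `F` is a set of finite perimeter: it is measurable and the variational
definition of the perimeter is finite. -/
def HasFinitePerimeter {n : ℕ} (F : Set (EuclideanSpace ℝ (Fin n))) : Prop :=
  MeasurableSet F ∧ BddAbove (perimVals F)

/-- The Newtonian interaction energy `NL(F) = ∫∫ χ_F(x)χ_F(y)|x-y|^{2-n}`. -/
def NL {n : ℕ} (F : Set (EuclideanSpace ℝ (Fin n))) : ℝ :=
  ∫ x in F, ∫ y in F, ‖x - y‖ ^ (2 - (n : ℝ))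

/-- The function `f_E = χ_{B_1} - χ_E`. -/
def fE {n : ℕ} (E : Set (EuclideanSpace ℝ (Fin n))) (x : EuclideanSpace ℝ (Fin n)) : ℝ :=
  (ball (0 : EuclideanSpace ℝ (Fin n)) 1).indicator 1 x - E.indicator 1 x

/-- The Newtonian potential `v(y) = ∫ (χ_{B_1} - χ_E)(x) |x-y|^{2-n} dx`. -/
def newtPot {n : ℕ} (E : Set (EuclideanSpace ℝ (Fin n))) (y : EuclideanSpace ℝ (Fin n)) : ℝ :=
  ∫ x, fE E x * ‖x - y‖ ^ (2 - (n : ℝ))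

/-- The normalization constant `σ_{n,α}` of the Riesz potential. -/
def rieszConst (n : ℕ) (α : ℝ) : ℝ :=
  (Real.pi ^ ((n : ℝ) / 2) * 2 ^ α * Real.Gamma (α / 2) / Real.Gamma (((n : ℝ) - α) / 2))⁻¹

/-- The Riesz potential `I_α f(x) = σ_{n,α} ∫ f(ξ)|x-ξ|^{α-n} dξ`. -/
def rieszPot {n : ℕ} (α : ℝ) (f : EuclideanSpace ℝ (Fin n) → ℝ)
    (x : EuclideanSpace ℝ (Fin n)) : ℝ :=
  rieszConst n α * ∫ ξ, f ξ * ‖x - ξ‖ ^ (α - (n : ℝ))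

/-- The average of `g` over the sphere `∂B_r` with respect to the
`(n-1)`-dimensional Hausdorff measure. -/
def sphAvg {n : ℕ} (g : EuclideanSpace ℝ (Fin n) → ℝ) (r : ℝ) : ℝ :=
  (μH[(n : ℝ) - 1] (sphere (0 : EuclideanSpace ℝ (Fin n)) r)).toReal⁻¹ *
    ∫ y in sphere (0 : EuclideanSpace ℝ (Fin n)) r, g y ∂μH[(n : ℝ) - 1]

/-- The average of `g` over the ball `B_r` with respect to the Lebesgue measure. -/
def ballAvg {n : ℕ} (g : EuclideanSpace ℝ (Fin n) → ℝ) (r : ℝ) : ℝ :=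
  (volume (ball (0 : EuclideanSpace ℝ (Fin n)) r)).toReal⁻¹ *
    ∫ x in ball (0 : EuclideanSpace ℝ (Fin n)) r, g x

end

section unif
open Filter Topology
variable {V : Type*} [NormedAddCommGroup V] [InnerProductSpace ℝ V] [FiniteDimensional ℝ V]
  [MeasurableSpace V] [BorelSpace V]

lemma unif_aux_const (r ε : ℝ) (μ : Measure V)
    (iμ : ∀ L : V ≃ₗᵢ[ℝ] V, μ.map L = μ) {x x' : V} (hx : x ∈ sphere (0:V) r)
    (hx' : x' ∈ sphere (0:V) r) :
    ∫ y, max 0 (ε - dist x' y) ∂μ = ∫ y, max 0 (ε - dist x y) ∂μ := by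
  have hn : ‖x‖ = ‖x'‖ := by simp at hx hx'; rw [hx, hx']
  let L : V ≃ₗᵢ[ℝ] V := (ℝ ∙ (x - x'))ᗮ.reflection
  have hL : L x = x' := Submodule.reflection_sub hn
  conv_lhs => rw [← iμ L]
  rw [integral_map L.continuous.aemeasurable (by fun_prop)]
  simp [← hL]

lemma unif_aux_pos (r ε : ℝ) (hε : 0 < ε) (μ : Measure V) [IsProbabilityMeasure μ]
    (hμ : μ (sphere 0 r)ᶜ = 0) :
    ∃ x ∈ sphere (0:V) r, 0 < ∫ y, max 0 (ε - dist x y) ∂μ := by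
  have h1 : μ (sphere (0:V) r) ≠ 0 := by
    intro h
    have : μ univ ≤ μ (sphere (0:V) r) + μ (sphere (0:V) r)ᶜ := by
      rw [← union_compl_self (sphere (0:V) r)]; exact measure_union_le _ _
    rw [h, hμ] at this
    simp at this
  obtain ⟨x, hx, h⟩ := exists_mem_forall_mem_nhdsWithin_pos_measure h1
  refine ⟨x, hx, ?_⟩
  have hi : Integrable (fun y => max 0 (ε - dist x y)) μ := by
    apply Integrable.of_bound (C := ε) (by fun_prop)
    filter_upwards with y
    have := dist_nonneg (x := x) (y := y)
    rw [Real.norm_eq_abs, abs_of_nonneg (le_max_left _ _)]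
    exact max_le hε.le (by linarith)
  refine (integral_pos_iff_support_of_nonneg (f := fun y => max 0 (ε - dist x y))
    (fun y => le_max_left _ _) hi).2 ?_
  have h2 := h (ball x ε) (mem_nhdsWithin_of_mem_nhds (ball_mem_nhds x hε))
  refine h2.trans_le (measure_mono ?_)
  intro y hy
  rw [mem_ball, dist_comm] at hy
  simp only [Function.mem_support]
  exact (lt_max_of_lt_right (by linarith)).ne'

theorem unif_unique (r : ℝ) (μ ν : Measure V) [IsProbabilityMeasure μ] [IsProbabilityMeasure ν]
    (hμ : μ (sphere 0 r)ᶜ = 0) (hν : ν (sphere 0 r)ᶜ = 0)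
    (iμ : ∀ L : V ≃ₗᵢ[ℝ] V, μ.map L = μ) (iν : ∀ L : V ≃ₗᵢ[ℝ] V, ν.map L = ν)
    (g : V → ℝ) (hg : Continuous g) (C : ℝ) (hC : ∀ x, |g x| ≤ C) :
    ∫ x, g x ∂μ = ∫ x, g x ∂ν := by
  have haeμ : ∀ᵐ x ∂μ, x ∈ sphere (0:V) r := hμ
  have haeν : ∀ᵐ x ∂ν, x ∈ sphere (0:V) r := hν
  have gi : ∀ (m : Measure V) [IsProbabilityMeasure m], Integrable g m := fun m _ =>
    Integrable.of_bound hg.aestronglyMeasurable C (ae_of_all _ hC)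
  rw [← sub_eq_zero, ← abs_nonpos_iff]
  refine le_of_forall_pos_le_add fun η hη => ?_
  rw [zero_add]
  have huc : UniformContinuousOn g (sphere (0:V) r) :=
    (isCompact_sphere 0 r).uniformContinuousOn_of_continuous hg.continuousOn
  obtain ⟨ε, hε, hd⟩ := Metric.uniformContinuousOn_iff.1 huc η hη
  let k : V → V → ℝ := fun x y => max 0 (ε - dist x y)
  have kc : Continuous (fun p : V × V => k p.1 p.2) := by fun_prop
  have kb : ∀ x y, |k x y| ≤ ε := fun x y => by
    have := dist_nonneg (x := x) (y := y)
    rw [abs_of_nonneg (le_max_left _ _)]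
    exact max_le hε.le (by linarith)
  have ksymm : ∀ x y, k x y = k y x := fun x y => by simp [k, dist_comm]
  obtain ⟨x0, hx0, hpos⟩ := unif_aux_pos r ε hε μ hμ
  set c := ∫ y, k x0 y ∂μ with hc
  have hpos : 0 < c := hpos
  have hcμ : ∀ x ∈ sphere (0:V) r, ∫ y, k x y ∂μ = c := fun x hx => unif_aux_const r ε μ iμ hx0 hx
  set d := ∫ y, k x0 y ∂ν with hdd
  have hcν : ∀ x ∈ sphere (0:V) r, ∫ y, k x y ∂ν = d := fun x hx => unif_aux_const r ε ν iν hx0 hx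
  have ki : Integrable (fun p : V × V => k p.1 p.2) (μ.prod ν) :=
    Integrable.of_bound kc.aestronglyMeasurable ε (ae_of_all _ fun p => kb _ _)
  have k1 : ∫ x, ∫ y, k x y ∂ν ∂μ = d := by
    rw [integral_congr_ae (g := fun _ => d) (by filter_upwards [haeμ] with x hx using hcν x hx)]
    simp
  have k2 : ∫ x, ∫ y, k x y ∂ν ∂μ = c := by
    rw [integral_integral_swap ki,
      integral_congr_ae (g := fun _ => c) (by
        filter_upwards [haeν] with x hx
        rw [← hcμ x hx]; simp_rw [ksymm])]
    simp
  have hcd : c = d := k2.symm.trans k1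
  have gk1 : Integrable (fun p : V × V => g p.1 * k p.1 p.2) (μ.prod ν) := by
    refine Integrable.of_bound (by fun_prop) (C * ε) (ae_of_all _ fun p => ?_)
    rw [Real.norm_eq_abs, abs_mul]
    exact mul_le_mul (hC _) (kb _ _) (abs_nonneg _) ((abs_nonneg _).trans (hC p.1))
  have gk2 : Integrable (fun p : V × V => g p.2 * k p.1 p.2) (μ.prod ν) := by
    refine Integrable.of_bound (by fun_prop) (C * ε) (ae_of_all _ fun p => ?_)
    rw [Real.norm_eq_abs, abs_mul]
    exact mul_le_mul (hC _) (kb _ _) (abs_nonneg _) ((abs_nonneg _).trans (hC p.1))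
  have e1 : ∫ p, g p.1 * k p.1 p.2 ∂(μ.prod ν) = c * ∫ x, g x ∂μ := by
    rw [integral_prod _ gk1, ← integral_const_mul]
    refine integral_congr_ae ?_
    filter_upwards [haeμ] with x hx
    simp only [integral_const_mul, hcν x hx, hcd]; ring
  have e2 : ∫ p, g p.2 * k p.1 p.2 ∂(μ.prod ν) = c * ∫ x, g x ∂ν := by
    rw [integral_prod_symm _ gk2, ← integral_const_mul]
    refine integral_congr_ae ?_
    filter_upwards [haeν] with x hx
    simp only [integral_const_mul]
    have : ∫ y, k y x ∂μ = c := by rw [← hcμ x hx]; simp_rw [ksymm]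
    rw [this]; ring
  have e3 : ∫ p, k p.1 p.2 ∂(μ.prod ν) = c := by rw [integral_prod _ ki]; exact k2
  have key : |c * (∫ x, g x ∂μ - ∫ x, g x ∂ν)| ≤ η * c := by
    rw [mul_sub, ← e1, ← e2, ← integral_sub gk1 gk2, ← Real.norm_eq_abs]
    refine (norm_integral_le_of_norm_le (ki.const_mul η) ?_).trans_eq (by rw [integral_const_mul, e3])
    have h1 : ∀ᵐ p ∂(μ.prod ν), p.1 ∈ sphere (0:V) r :=
      Measure.quasiMeasurePreserving_fst.ae haeμ
    have h2 : ∀ᵐ p ∂(μ.prod ν), p.2 ∈ sphere (0:V) r :=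
      Measure.quasiMeasurePreserving_snd.ae haeν
    filter_upwards [h1, h2] with p hp1 hp2
    rw [← sub_mul, Real.norm_eq_abs, abs_mul, abs_of_nonneg (a := k _ _) (le_max_left _ _)]
    by_cases hdist : dist p.1 p.2 < ε
    · refine mul_le_mul_of_nonneg_right ?_ (le_max_left _ _)
      exact (hd _ hp1 _ hp2 hdist).le
    · have : k p.1 p.2 = 0 := max_eq_left (by linarith)
      simp [this]
  rw [abs_mul, abs_of_pos hpos, mul_comm] at key
  exact le_of_mul_le_mul_right key hpos
end unif



section sph
open scoped Pointwise
variable {n : ℕ}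

local notation "V" => EuclideanSpace ℝ (Fin n)

lemma toSphere_map_inv (s : ℝ) (L : V ≃ₗᵢ[ℝ] V) :
    (((volume : Measure V).toSphere.map (fun ω : sphere (0:V) 1 => s • (ω : V))).map L) =
      ((volume : Measure V).toSphere.map (fun ω : sphere (0:V) 1 => s • (ω : V))) := by
  have hm : Measurable (fun ω : sphere (0:V) 1 => s • (ω : V)) := by fun_prop
  have hL : Measurable L := L.continuous.measurable
  ext A hA
  rw [Measure.map_apply hL hA, Measure.map_apply hm (hL hA), Measure.map_apply hm hA,
    Measure.toSphere_apply' _ (hm (hL hA)), Measure.toSphere_apply' _ (hm hA)]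
  congr 1
  have hpre := L.measurePreserving.measure_preimage_emb L.toHomeomorph.measurableEmbedding
    (Ioo (0:ℝ) 1 • (Subtype.val '' ((fun ω : sphere (0:V) 1 => s • (ω : V)) ⁻¹' A)))
  rw [← hpre]
  congr 1
  ext x
  simp only [Set.mem_smul, mem_image, mem_preimage, Subtype.exists, mem_sphere_iff_norm, sub_zero]
  constructor
  · rintro ⟨t, ht, y, ⟨a, ha, h, rfl⟩, rfl⟩
    exact ⟨t, ht, L a, ⟨L a, by simpa using ha, by simpa using h, rfl⟩, by simp⟩
  · rintro ⟨t, ht, y, ⟨a, ha, h, rfl⟩, h2⟩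
    refine ⟨t, ht, L.symm a, ⟨L.symm a, by simpa using ha, by simpa using h, rfl⟩, ?_⟩
    apply L.injective
    simpa using h2

lemma hausdorff_inv (r : ℝ) (L : V ≃ₗᵢ[ℝ] V) :
    ((μH[(n:ℝ)-1] : Measure V).restrict (sphere 0 r)).map L = (μH[(n:ℝ)-1]).restrict (sphere 0 r) := by
  have h := (L.toIsometryEquiv.measurePreserving_hausdorffMeasure ((n:ℝ)-1)).restrict_preimage_emb
    L.toHomeomorph.measurableEmbedding (sphere (0:V) r)
  have h2 : (L.toIsometryEquiv ⁻¹' (sphere (0:V) r)) = sphere 0 r := by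
    ext x; simp
  rw [h2] at h
  exact h.map_eq

/-- nondegeneracy -/
def SphOK (n : ℕ) : Prop := μH[(n:ℝ)-1] (sphere (0 : EuclideanSpace ℝ (Fin n)) 1) ≠ 0 ∧
   μH[(n:ℝ)-1] (sphere (0 : EuclideanSpace ℝ (Fin n)) 1) ≠ ⊤

lemma haus_scale (hn : 1 ≤ n) {r : ℝ} (hr : 0 < r) :
    ∃ c : NNReal, c ≠ 0 ∧ μH[(n:ℝ)-1] (sphere (0 : V) r) = c * μH[(n:ℝ)-1] (sphere (0 : V) 1) := by
  have : Nonempty (Fin n) := ⟨⟨0, hn⟩⟩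
  have hd : (0:ℝ) ≤ (n:ℝ) - 1 := by
    have : (1:ℝ) ≤ n := by exact_mod_cast hn
    linarith
  have h := Measure.hausdorffMeasure_smul₀ (E := V) hd hr.ne' (sphere (0:V) 1)
  rw [_root_.smul_sphere _ _ zero_le_one, smul_zero, Real.norm_eq_abs, abs_of_pos hr, mul_one] at h
  refine ⟨‖r‖₊ ^ ((n:ℝ)-1), ?_, ?_⟩
  · apply ne_of_gt
    apply NNReal.rpow_pos
    simpa using hr.ne'
  · rw [h]; rfl

lemma sphAvg_not_ok (hn : 1 ≤ n) (h : ¬ SphOK n) (g : V → ℝ) {r : ℝ} (hr : 0 < r) :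
    sphAvg g r = 0 := by
  obtain ⟨c, hc, h2⟩ := haus_scale hn hr
  have : (μH[(n : ℝ) - 1] (sphere (0 : V) r)).toReal = 0 := by
    rw [h2]
    by_cases h0 : μH[(n:ℝ)-1] (sphere (0 : V) 1) = 0
    · simp [h0]
    · have : μH[(n:ℝ)-1] (sphere (0 : V) 1) = ⊤ := by
        by_contra h3; exact h ⟨h0, h3⟩
      rw [this]; simp [hc]
  simp [sphAvg, this]

/-- total mass of the sphere measure -/
noncomputable def sphMass (n : ℕ) : ℝ := (volume : Measure (EuclideanSpace ℝ (Fin n))).toSphere.real univ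

lemma sphMass_pos (hn : 1 ≤ n) : 0 < sphMass n := by
  have : Nonempty (Fin n) := ⟨⟨0, hn⟩⟩
  have : (volume : Measure V).toSphere ≠ 0 := Measure.toSphere_ne_zero _
  rw [sphMass, measureReal_def, ENNReal.toReal_pos_iff]
  exact ⟨by rw [pos_iff_ne_zero, Ne, Measure.measure_univ_eq_zero]; exact this, measure_lt_top _ _⟩

lemma sphAvg_eq (hn : 1 ≤ n) (hok : SphOK n) (g : V → ℝ) (hg : Continuous g) (C : ℝ)
    (hC : ∀ x, |g x| ≤ C) {r : ℝ} (hr : 0 < r) :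
    ∫ ω : sphere (0:V) 1, g (r • (ω:V)) ∂(volume : Measure V).toSphere = sphMass n * sphAvg g r := by
  obtain ⟨c, hc, h2⟩ := haus_scale hn hr
  set H := (μH[(n:ℝ)-1] : Measure V).restrict (sphere 0 r) with hH
  set T := ((volume : Measure V).toSphere.map (fun ω : sphere (0:V) 1 => r • (ω : V))) with hT
  have hm : Measurable (fun ω : sphere (0:V) 1 => r • (ω : V)) := by fun_prop
  have hHu : H univ = μH[(n:ℝ)-1] (sphere (0 : V) r) := by simp [hH]
  have hH0 : H univ ≠ 0 := by rw [hHu, h2]; simp [hc, hok.1]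
  have hH1 : H univ ≠ ⊤ := by rw [hHu, h2]; exact ENNReal.mul_ne_top (by simp) hok.2
  have hTu : T univ = (volume : Measure V).toSphere univ := by
    rw [hT, Measure.map_apply hm .univ, preimage_univ]
  have hTpos := sphMass_pos hn
  have hT0 : T univ ≠ 0 := by
    rw [hTu]; intro h; simp [sphMass, measureReal_def, h] at hTpos
  have hT1 : T univ ≠ ⊤ := by rw [hTu]; exact measure_ne_top _ _
  have : IsProbabilityMeasure ((H univ)⁻¹ • H) := ⟨by simp [ENNReal.inv_mul_cancel hH0 hH1]⟩
  have : IsProbabilityMeasure ((T univ)⁻¹ • T) := ⟨by simp [ENNReal.inv_mul_cancel hT0 hT1]⟩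
  have key := unif_unique r ((T univ)⁻¹ • T) ((H univ)⁻¹ • H) ?_ ?_ ?_ ?_ g hg C hC
  · rw [integral_smul_measure, integral_smul_measure, hTu, hHu, hT,
      integral_map hm.aemeasurable hg.aestronglyMeasurable] at key
    rw [sphAvg]
    simp only [ENNReal.toReal_inv, smul_eq_mul] at key
    rw [← key, sphMass, measureReal_def, ← mul_assoc, mul_inv_cancel₀, one_mul]
    exact hTpos.ne'
  · rw [Measure.smul_apply, hT, Measure.map_apply hm isClosed_sphere.measurableSet.compl]
    have : (fun ω : sphere (0:V) 1 => r • (ω : V)) ⁻¹' (sphere 0 r)ᶜ = ∅ := by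
      ext ω; simp [norm_smul, abs_of_pos hr]
    simp [this]
  · rw [Measure.smul_apply, hH, Measure.restrict_apply isClosed_sphere.measurableSet.compl]
    simp
  · intro L; rw [Measure.map_smul, hT, toSphere_map_inv]
  · intro L; rw [Measure.map_smul, hH, hausdorff_inv]

/-- polar coordinates -/
lemma polar (hn : 1 ≤ n) (hok : SphOK n) (g : V → ℝ) (hg : Continuous g) (C : ℝ)
    (hC : ∀ x, |g x| ≤ C) (w : ℝ → ℝ) (hi : Integrable (fun x : V => g x * w ‖x‖)) :
    ∫ x : V, g x * w ‖x‖ = sphMass n * ∫ r : Ioi (0:ℝ), sphAvg g r * w r ∂(Measure.volumeIoiPow (n-1)) ∧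
    Integrable (fun r : Ioi (0:ℝ) => sphAvg g r * w r) (Measure.volumeIoiPow (n-1)) := by
  have : Nonempty (Fin n) := ⟨⟨0, hn⟩⟩
  have hmp := (volume : Measure V).measurePreserving_homeomorphUnitSphereProd
  rw [finrank_euclideanSpace_fin] at hmp
  have hemb := (homeomorphUnitSphereProd V).measurableEmbedding
  let G : sphere (0:V) 1 × Ioi (0:ℝ) → ℝ := fun p => g ((p.2 : ℝ) • (p.1 : V)) * w p.2
  have hG : ∀ x : ({0}ᶜ : Set V), G (homeomorphUnitSphereProd V x) = g x * w ‖(x:V)‖ := by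
    intro x
    have hx : ‖(x:V)‖ ≠ 0 := by
      rw [norm_ne_zero_iff]; exact x.2
    simp [G, homeomorphUnitSphereProd, smul_smul, hx]
  have h1 : ∫ x : V, g x * w ‖x‖ = ∫ x : ({0}ᶜ : Set V), g x * w ‖(x:V)‖ ∂((volume : Measure V).comap (↑)) := by
    rw [integral_subtype_comap (measurableSet_singleton _).compl fun x => g x * w ‖x‖, restrict_compl_singleton]
  have h2 := hmp.integral_comp hemb G
  have hiG : Integrable G ((volume : Measure V).toSphere.prod (.volumeIoiPow (n-1))) := by
    rw [← hmp.integrable_comp_emb hemb]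
    have : (G ∘ homeomorphUnitSphereProd V) = (fun x => g x * w ‖x‖) ∘ (Subtype.val : ({0}ᶜ : Set V) → V) := by
      funext x; simp [hG]
    rw [this, ← integrableOn_iff_comap_subtypeVal (measurableSet_singleton _).compl, IntegrableOn, restrict_compl_singleton]
    exact hi
  have hin : ∀ r : Ioi (0:ℝ), ∫ ω, G (ω, r) ∂(volume : Measure V).toSphere = sphMass n * (sphAvg g r * w r) := by
    intro r
    simp only [G]
    rw [integral_mul_const, sphAvg_eq hn hok g hg C hC r.2]
    ring
  constructor
  swap
  · have := hiG.integral_prod_right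
    simp_rw [hin] at this
    exact (integrable_const_mul_iff (IsUnit.mk0 _ (sphMass_pos hn).ne') _).1 this
  rw [h1, ← integral_const_mul]
  simp_rw [← hG]
  rw [h2, integral_prod_symm _ hiG]
  simp_rw [hin]

end sph
section pot
open Filter Topology
variable {n : ℕ}
local notation "V" => EuclideanSpace ℝ (Fin n)

lemma ker_integrableOn (hn : 1 ≤ n) {γ : ℝ} (hγ : -(n:ℝ) < γ) (δ : ℝ) :
    IntegrableOn (fun x : V => ‖x‖ ^ γ) (ball 0 δ) := by
  refine integrableOn_ball_of_norm_le_rpow (C := 1) (α := -γ) (by simpa using hn)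
    (by simp; linarith) (ae_of_all _ fun x => ?_)
    (measurable_norm.pow_const γ).aestronglyMeasurable
  rw [neg_neg, one_mul, Real.norm_eq_abs, abs_of_nonneg (by positivity)]

lemma ker_small (hn : 1 ≤ n) {γ : ℝ} (hγ : -(n:ℝ) < γ) {η : ℝ} (hη : 0 < η) :
    ∃ δ > 0, ∫ x in ball (0:V) δ, ‖x‖ ^ γ < η := by
  have : Nonempty (Fin n) := ⟨⟨0, hn⟩⟩
  have h := tendsto_setIntegral_of_antitone (μ := (volume : Measure V)) (f := fun x : V => ‖x‖ ^ γ)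
    (s := fun k : ℕ => ball (0:V) (1 / ((k:ℝ)+1))) (fun i => measurableSet_ball)
    (fun i j hij => ball_subset_ball (by gcongr)) ⟨0, ker_integrableOn hn hγ _⟩
  have hz : (⋂ k : ℕ, ball (0:V) (1 / ((k:ℝ)+1))) = {0} := by
    ext x
    simp only [mem_iInter, mem_ball_zero_iff, mem_singleton_iff]
    constructor
    · intro hx
      by_contra h0
      obtain ⟨k, hk⟩ := exists_nat_one_div_lt (norm_pos_iff.2 h0)
      exact lt_asymm hk (hx k)
    · rintro rfl k
      simp; positivity
  rw [hz] at h
  simp only [Measure.restrict_singleton, measure_singleton, zero_smul, integral_zero_measure] at h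
  obtain ⟨k, hk⟩ := (h.eventually_lt_const hη).exists
  exact ⟨_, by positivity, hk⟩

/-- singular part of the kernel -/
noncomputable def kerH (γ δ : ℝ) (x : V) : ℝ := ‖x‖ ^ γ - (max ‖x‖ δ) ^ γ

lemma kerH_zero {γ δ : ℝ} {x : V} (hx : x ∉ ball (0:V) δ) : kerH γ δ x = 0 := by
  have : δ ≤ ‖x‖ := by simpa using hx
  rw [kerH, max_eq_left this, sub_self]

lemma kerH_integrable (hn : 1 ≤ n) {γ : ℝ} (hγ : -(n:ℝ) < γ) {δ : ℝ} (hδ : 0 < δ) :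
    Integrable (kerH γ δ : V → ℝ) := by
  have : IntegrableOn (kerH γ δ : V → ℝ) (ball 0 δ) := by
    refine (ker_integrableOn hn hγ δ).sub ?_
    refine IntegrableOn.congr_fun (f := fun _ => δ ^ γ) ?_ ?_ measurableSet_ball
    · exact integrableOn_const (by simpa using measure_ball_lt_top.ne)
    · intro x hx
      have : ‖x‖ ≤ δ := (mem_ball_zero_iff.1 hx).le
      simp [max_eq_right this]
  rwa [integrableOn_iff_integrable_of_support_subset] at this
  intro x hx
  by_contra h
  exact hx (kerH_zero h)

lemma kerH_bound (hn : 1 ≤ n) {γ : ℝ} (hγ0 : γ < 0) {δ : ℝ} (_hδ : 0 < δ) :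
    ∀ᵐ x : V, |kerH γ δ x| ≤ (ball (0:V) δ).indicator (fun x => ‖x‖ ^ γ) x := by
  have : Nonempty (Fin n) := ⟨⟨0, hn⟩⟩
  filter_upwards [compl_mem_ae_iff.2 (measure_singleton (0:V))] with x hx
  by_cases h : x ∈ ball (0:V) δ
  · rw [indicator_of_mem h, kerH]
    have hx0 : 0 < ‖x‖ := norm_pos_iff.2 hx
    have h1 : (max ‖x‖ δ) ^ γ ≤ ‖x‖ ^ γ :=
      Real.rpow_le_rpow_of_nonpos hx0 (le_max_left _ _) hγ0.le
    have h2 : 0 ≤ (max ‖x‖ δ) ^ γ := by positivity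
    rw [abs_of_nonneg (by linarith)]; linarith
  · rw [kerH_zero h, indicator_of_notMem h]; simp

lemma kerH_integral (hn : 1 ≤ n) {γ : ℝ} (hγ : -(n:ℝ) < γ) (hγ0 : γ < 0) {δ : ℝ} (hδ : 0 < δ) :
    ∫ x : V, |kerH γ δ x| ≤ ∫ x in ball (0:V) δ, ‖x‖ ^ γ := by
  rw [← integral_indicator measurableSet_ball]
  exact integral_mono_ae (kerH_integrable hn hγ hδ).abs
    ((integrable_indicator_iff measurableSet_ball).2 (ker_integrableOn hn hγ δ)) (kerH_bound hn hγ0 hδ)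

lemma kerM_bound {γ : ℝ} (hγ0 : γ < 0) {δ : ℝ} (hδ : 0 < δ) (x : V) :
    |(max ‖x‖ δ) ^ γ| ≤ δ ^ γ := by
  rw [abs_of_nonneg (by positivity)]
  exact Real.rpow_le_rpow_of_nonpos hδ (le_max_right _ _) hγ0.le

lemma kerM_cont {γ : ℝ} {δ : ℝ} (hδ : 0 < δ) : Continuous (fun x : V => (max ‖x‖ δ) ^ γ) := by
  refine Continuous.rpow_const (by fun_prop) fun x => Or.inl ?_
  exact (lt_max_of_lt_right hδ).ne'

lemma intH (hn : 1 ≤ n) {γ : ℝ} (hγ : -(n:ℝ) < γ) {δ : ℝ} (hδ : 0 < δ)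
    {f : V → ℝ} (hf : Integrable f) {M : ℝ} (hM : ∀ x, |f x| ≤ M) (x : V) :
    Integrable (fun ξ => f ξ * kerH γ δ (x - ξ)) := by
  refine Integrable.bdd_mul ((kerH_integrable hn hγ hδ).comp_sub_left x) hf.1 (ae_of_all _ hM)

lemma intM {γ : ℝ} (hγ0 : γ < 0) {δ : ℝ} (hδ : 0 < δ)
    {f : V → ℝ} (hf : Integrable f) (x : V) :
    Integrable (fun ξ => f ξ * (max ‖x - ξ‖ δ) ^ γ) := by
  refine hf.mul_bdd (c := δ ^ γ) ?_ (ae_of_all _ fun ξ => kerM_bound hγ0 hδ _)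
  exact ((kerM_cont hδ).comp (by fun_prop : Continuous fun ξ => x - ξ)).aestronglyMeasurable

lemma pot_split (hn : 1 ≤ n) {γ : ℝ} (hγ : -(n:ℝ) < γ) (hγ0 : γ < 0) {δ : ℝ} (hδ : 0 < δ)
    {f : V → ℝ} (hf : Integrable f) {M : ℝ} (hM : ∀ x, |f x| ≤ M) (x : V) :
    ∫ ξ, f ξ * ‖x - ξ‖ ^ γ = (∫ ξ, f ξ * (max ‖x - ξ‖ δ) ^ γ) + ∫ ξ, f ξ * kerH γ δ (x - ξ) := by
  rw [← integral_add (intM hγ0 hδ hf x) (intH hn hγ hδ hf hM x)]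
  congr 1; funext ξ; rw [kerH]; ring

lemma pot_H_bound (hn : 1 ≤ n) {γ : ℝ} (hγ : -(n:ℝ) < γ) (hγ0 : γ < 0) {δ : ℝ} (hδ : 0 < δ)
    {f : V → ℝ} {M : ℝ} (hM0 : 0 ≤ M) (hM : ∀ x, |f x| ≤ M) (x : V) :
    |∫ ξ, f ξ * kerH γ δ (x - ξ)| ≤ M * ∫ x in ball (0:V) δ, ‖x‖ ^ γ := by
  have hi : Integrable (fun ξ : V => M * |kerH γ δ (x - ξ)|) :=
    (((kerH_integrable hn hγ hδ).abs).comp_sub_left x).const_mul M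
  rw [← Real.norm_eq_abs]
  refine (norm_integral_le_of_norm_le hi (ae_of_all _ fun ξ => ?_)).trans ?_
  · rw [Real.norm_eq_abs, abs_mul]
    exact mul_le_mul_of_nonneg_right (hM ξ) (abs_nonneg _)
  · rw [integral_const_mul]
    rw [integral_sub_left_eq_self (fun y : V => |kerH γ δ y|)]
    exact mul_le_mul_of_nonneg_left (kerH_integral hn hγ hγ0 hδ) hM0

lemma pot_M_cont {γ : ℝ} (hγ0 : γ < 0) {δ : ℝ} (hδ : 0 < δ)
    {f : V → ℝ} (hf : Integrable f) : Continuous (fun x : V => ∫ ξ, f ξ * (max ‖x - ξ‖ δ) ^ γ) := by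
  refine continuous_of_dominated (bound := fun ξ => |f ξ| * δ ^ γ) (fun x => (intM hγ0 hδ hf x).1)
    (fun x => ae_of_all _ fun ξ => ?_) (hf.abs.mul_const _) (ae_of_all _ fun ξ => ?_)
  · rw [Real.norm_eq_abs, abs_mul]
    exact mul_le_mul_of_nonneg_left (kerM_bound hγ0 hδ _) (abs_nonneg _)
  · exact continuous_const.mul ((kerM_cont hδ).comp (by fun_prop : Continuous fun x => x - ξ))

lemma pot_M_decay {γ : ℝ} (hγ0 : γ < 0) {δ : ℝ} (hδ : 0 < δ)
    {f : V → ℝ} (hf : Integrable f) :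
    Tendsto (fun x : V => ∫ ξ, f ξ * (max ‖x - ξ‖ δ) ^ γ) (cocompact V) (𝓝 0) := by
  have : (cocompact V).IsCountablyGenerated := by
    rw [← Metric.cobounded_eq_cocompact, ← comap_norm_atTop]; infer_instance
  rw [show (0:ℝ) = ∫ ξ : V, (0:ℝ) by simp]
  refine tendsto_integral_filter_of_dominated_convergence (fun ξ => |f ξ| * δ ^ γ)
    (Eventually.of_forall fun x => (intM hγ0 hδ hf x).1)
    (Eventually.of_forall fun x => ae_of_all _ fun ξ => ?_) (hf.abs.mul_const _) (ae_of_all _ fun ξ => ?_)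
  · rw [Real.norm_eq_abs, abs_mul]
    exact mul_le_mul_of_nonneg_left (kerM_bound hγ0 hδ _) (abs_nonneg _)
  · have h1 : Tendsto (fun x : V => ‖x - ξ‖) (cocompact V) atTop := by
      refine tendsto_atTop_mono (fun x => norm_sub_norm_le x ξ) ?_
      exact tendsto_atTop_add_const_right _ _ (tendsto_norm_cocompact_atTop)
    have h2 : Tendsto (fun x : V => max ‖x - ξ‖ δ) (cocompact V) atTop :=
      tendsto_atTop_mono (fun x => le_max_left _ _) h1
    have h3 := (tendsto_rpow_neg_atTop (y := -γ) (by linarith)).comp h2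
    simpa using h3.const_mul (f ξ)

lemma pot_cont (hn : 1 ≤ n) {γ : ℝ} (hγ : -(n:ℝ) < γ) (hγ0 : γ < 0)
    {f : V → ℝ} (hf : Integrable f) {M : ℝ} (hM0 : 0 < M) (hM : ∀ x, |f x| ≤ M) :
    Continuous (fun x : V => ∫ ξ, f ξ * ‖x - ξ‖ ^ γ) := by
  refine continuous_of_uniform_approx_of_continuous fun u hu => ?_
  obtain ⟨ε, hε, hεu⟩ := Metric.mem_uniformity_dist.1 hu
  obtain ⟨δ, hδ, hs⟩ := ker_small hn hγ (div_pos hε hM0)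
  refine ⟨_, pot_M_cont hγ0 hδ hf, fun x => hεu ?_⟩
  rw [pot_split hn hγ hγ0 hδ hf hM x, Real.dist_eq, add_sub_cancel_left]
  refine (pot_H_bound hn hγ hγ0 hδ hM0.le hM x).trans_lt ?_
  rw [lt_div_iff₀ hM0] at hs
  linarith

lemma pot_decay (hn : 1 ≤ n) {γ : ℝ} (hγ : -(n:ℝ) < γ) (hγ0 : γ < 0)
    {f : V → ℝ} (hf : Integrable f) {M : ℝ} (hM0 : 0 < M) (hM : ∀ x, |f x| ≤ M) :
    Tendsto (fun x : V => ∫ ξ, f ξ * ‖x - ξ‖ ^ γ) (cocompact V) (𝓝 0) := by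
  rw [Metric.tendsto_nhds]
  intro ε hε
  obtain ⟨δ, hδ, hs⟩ := ker_small hn hγ (div_pos (half_pos hε) hM0)
  filter_upwards [Metric.tendsto_nhds.1 (pot_M_decay hγ0 hδ hf) (ε/2) (half_pos hε)] with x hx
  have h1 := pot_H_bound hn hγ hγ0 hδ hM0.le hM x
  rw [lt_div_iff₀ hM0] at hs
  rw [pot_split hn hγ hγ0 hδ hf hM x, Real.dist_eq, sub_zero]
  rw [Real.dist_eq, sub_zero] at hx
  refine (abs_add_le _ _).trans_lt ?_
  linarith

lemma pot_bdd (hn : 1 ≤ n) {γ : ℝ} (hγ : -(n:ℝ) < γ) (hγ0 : γ < 0)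
    {f : V → ℝ} (hf : Integrable f) {M : ℝ} (hM0 : 0 < M) (hM : ∀ x, |f x| ≤ M) :
    ∃ C, ∀ x : V, |∫ ξ, f ξ * ‖x - ξ‖ ^ γ| ≤ C := by
  refine ⟨(∫ ξ, |f ξ| * 1 ^ γ) + M * ∫ x in ball (0:V) 1, ‖x‖ ^ γ, fun x => ?_⟩
  rw [pot_split hn hγ hγ0 one_pos hf hM x]
  refine (abs_add_le _ _).trans (add_le_add ?_ (pot_H_bound hn hγ hγ0 one_pos hM0.le hM x))
  rw [← Real.norm_eq_abs]
  refine norm_integral_le_of_norm_le (hf.abs.mul_const _) (ae_of_all _ fun ξ => ?_)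
  rw [Real.norm_eq_abs, abs_mul]
  exact mul_le_mul_of_nonneg_left (kerM_bound hγ0 one_pos _) (abs_nonneg _)

lemma pot_fubini (hn : 1 ≤ n) {γ : ℝ} (hγ : -(n:ℝ) < γ) (hγ0 : γ < 0)
    {f : V → ℝ} (hf : Integrable f)
    {ψ : V → ℝ} (hψ : Continuous ψ) (hψc : HasCompactSupport ψ) :
    ∫ x, (∫ ξ, f ξ * ‖x - ξ‖ ^ γ) * ψ x = ∫ ξ, f ξ * ∫ x, ‖x - ξ‖ ^ γ * ψ x := by
  have hψi : Integrable ψ := hψ.integrable_of_hasCompactSupport hψc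
  obtain ⟨B, hB⟩ := hψ.bounded_above_of_compact_support hψc
  have h1 : Integrable (fun p : V × V => f p.2 * kerH γ 1 (p.1 - p.2) * ψ p.1) (volume.prod volume) := by
    refine Integrable.mul_bdd (c := B) ?_ (by fun_prop) (ae_of_all _ fun p => hB _)
    exact Integrable.convolution_integrand (ContinuousLinearMap.mul ℝ ℝ) hf (kerH_integrable hn hγ one_pos)
  have h2 : Integrable (fun p : V × V => (ψ p.1 * f p.2) * (max ‖p.1 - p.2‖ 1) ^ γ) (volume.prod volume) := by
    refine Integrable.mul_bdd (c := 1 ^ γ) (hψi.mul_prod hf) ?_ (ae_of_all _ fun p => kerM_bound hγ0 one_pos _)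
    exact ((kerM_cont one_pos).comp (by fun_prop : Continuous fun p : V × V => p.1 - p.2)).aestronglyMeasurable
  have h3 : Integrable (Function.uncurry fun x ξ : V => f ξ * ‖x - ξ‖ ^ γ * ψ x) (volume.prod volume) := by
    refine (h1.add h2).congr (ae_of_all _ fun p => ?_)
    simp only [Function.uncurry, Pi.add_apply, kerH]
    ring
  have := integral_integral_swap h3
  simp_rw [integral_mul_const, mul_assoc, integral_const_mul] at this
  exact this
end pot
section ibp
open Filter Topology
variable {n : ℕ}
local notation "V" => EuclideanSpace ℝ (Fin n)

lemma int_lineDeriv_zero (F F' : V → ℝ) (v : V) (hF : Integrable F) (hF' : Integrable F')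
    (h : ∀ x, HasDerivAt (fun t : ℝ => F (x + t • v)) (F' x) 0) : ∫ x, F' x = 0 := by
  have := integral_bilinear_hasLineDerivAt_right_eq_neg_left_of_integrable (μ := (volume : Measure V))
    (f := fun _ : V => (1:ℝ)) (f' := fun _ => 0) (g := F) (g' := F') (v := v)
    (B := ContinuousLinearMap.mul ℝ ℝ) (by simp) (by simpa using hF') (by simpa using hF)
    (fun x _ => by simpa [HasLineDerivAt] using hasDerivAt_const (0:ℝ) (1:ℝ)) (fun x _ => h x)
  simpa using this

lemma deriv_normsq (x : V) (i : Fin n) :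
    HasDerivAt (fun t : ℝ => ‖x + t • (EuclideanSpace.single i (1:ℝ) : V)‖ ^ 2) (2 * x i) 0 := by
  have h1 : HasDerivAt (fun t : ℝ => x + t • (EuclideanSpace.single i (1:ℝ) : V))
      (EuclideanSpace.single i (1:ℝ) : V) 0 := by
    simpa using ((hasDerivAt_id (0:ℝ)).smul_const (EuclideanSpace.single i (1:ℝ) : V)).const_add x
  have := h1.norm_sq
  simpa [EuclideanSpace.inner_single_right] using this

lemma deriv_coord (x : V) (i : Fin n) :
    HasDerivAt (fun t : ℝ => (x + t • (EuclideanSpace.single i (1:ℝ) : V)) i) 1 0 := by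
  simpa using (hasDerivAt_id (0:ℝ)).const_add (x i)

lemma ibp (P P1 P2 : ℝ → ℝ) (hP : ∀ s, HasDerivAt P (P1 s) s) (hP1 : ∀ s, HasDerivAt P1 (P2 s) s)
    (hP2 : Continuous P2) (L : ℝ) (z0 : ∀ s, L ≤ s → P s = 0) (z1 : ∀ s, L ≤ s → P1 s = 0)
    (z2 : ∀ s, L ≤ s → P2 s = 0)
    (a a1 a2 : ℝ → ℝ) (ha : ∀ s, 0 < s → HasDerivAt a (a1 s) s)
    (ha1 : ∀ s, 0 < s → HasDerivAt a1 (a2 s) s) (ha2 : ContinuousOn a2 (Ioi 0)) (ξ : V) (e : ℝ)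
    (he : 0 < e) :
    ∫ x : V, a (‖x - ξ‖ ^ 2 + e) * (2 * n * P1 (‖x‖ ^ 2) + 4 * ‖x‖ ^ 2 * P2 (‖x‖ ^ 2)) =
    ∫ x : V, (2 * n * a1 (‖x - ξ‖ ^ 2 + e) + 4 * ‖x - ξ‖ ^ 2 * a2 (‖x - ξ‖ ^ 2 + e)) * P (‖x‖ ^ 2) := by
  have cP : Continuous P := continuous_iff_continuousAt.2 fun s => (hP s).continuousAt
  have cP1 : Continuous P1 := continuous_iff_continuousAt.2 fun s => (hP1 s).continuousAt
  have Qpos : ∀ x : V, 0 < ‖x - ξ‖ ^ 2 + e := fun x => by positivity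
  have cQ : Continuous fun x : V => ‖x - ξ‖ ^ 2 + e := by fun_prop
  have cA : Continuous fun x : V => a (‖x - ξ‖ ^ 2 + e) :=
    continuous_iff_continuousAt.2 fun x =>
      ContinuousAt.comp (f := fun x : V => ‖x - ξ‖ ^ 2 + e) (ha _ (Qpos x)).continuousAt cQ.continuousAt
  have cA1 : Continuous fun x : V => a1 (‖x - ξ‖ ^ 2 + e) :=
    continuous_iff_continuousAt.2 fun x =>
      ContinuousAt.comp (f := fun x : V => ‖x - ξ‖ ^ 2 + e) (ha1 _ (Qpos x)).continuousAt cQ.continuousAt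
  have cA2 : Continuous fun x : V => a2 (‖x - ξ‖ ^ 2 + e) :=
    ha2.comp_continuous cQ Qpos
  have cq : Continuous fun x : V => ‖x‖ ^ 2 := by fun_prop
  have cp0 : Continuous fun x : V => P (‖x‖ ^ 2) := cP.comp cq
  have cp1 : Continuous fun x : V => P1 (‖x‖ ^ 2) := cP1.comp cq
  have cp2 : Continuous fun x : V => P2 (‖x‖ ^ 2) := hP2.comp cq
  have cc : ∀ c : ℝ, Continuous fun _ : V => c := fun c => continuous_const
  have cs : ∀ g : V → ℝ, Continuous g → (∀ x, L ≤ ‖x‖ ^ 2 → g x = 0) → Integrable g := by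
    intro g hg hz
    refine hg.integrable_of_hasCompactSupport ?_
    refine HasCompactSupport.intro (isCompact_closedBall (0:V) (|L| + 1)) fun x hx => hz x ?_
    have : |L| + 1 < ‖x‖ := by simpa using hx
    nlinarith [le_abs_self L, abs_nonneg L]
  let D : Fin n → V → ℝ := fun i x =>
    (2 * a (‖x - ξ‖ ^ 2 + e) * P1 (‖x‖ ^ 2) + 4 * a (‖x - ξ‖ ^ 2 + e) * P2 (‖x‖ ^ 2) * (x i) ^ 2)
     - (2 * P (‖x‖ ^ 2) * a1 (‖x - ξ‖ ^ 2 + e) + 4 * P (‖x‖ ^ 2) * a2 (‖x - ξ‖ ^ 2 + e) * ((x - ξ) i) ^ 2)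
  let F : Fin n → V → ℝ := fun i x =>
    2 * (a (‖x - ξ‖ ^ 2 + e) * P1 (‖x‖ ^ 2) * x i) - 2 * (P (‖x‖ ^ 2) * a1 (‖x - ξ‖ ^ 2 + e) * (x - ξ) i)
  have iF : ∀ i, Integrable (F i) := fun i => by
    refine cs _ (((cc 2).mul ((cA.mul cp1).mul (by fun_prop))).sub ((cc 2).mul ((cp0.mul cA1).mul (by fun_prop)))) fun x hx => ?_
    simp [F, z0 _ hx, z1 _ hx]
  have iD : ∀ i, Integrable (D i) := fun i => by
    refine cs _ (((((cc 2).mul cA).mul cp1).add ((((cc 4).mul cA).mul cp2).mul (by fun_prop))).sub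
      ((((cc 2).mul cp0).mul cA1).add ((((cc 4).mul cp0).mul cA2).mul (by fun_prop)))) fun x hx => ?_
    simp [D, z0 _ hx, z1 _ hx, z2 _ hx]
  have hD : ∀ i, ∫ x, D i x = 0 := by
    intro i
    refine int_lineDeriv_zero (F i) (D i) (EuclideanSpace.single i (1:ℝ)) (iF i) (iD i) fun x => ?_
    have e0 : ∀ y : V, y + (0:ℝ) • (EuclideanSpace.single i (1:ℝ) : V) = y := by simp
    have d1 := deriv_normsq x i
    have d2 := deriv_normsq (x - ξ) i
    have d3 := deriv_coord x i
    have d4 := deriv_coord (x - ξ) i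
    have hsub : ∀ t : ℝ, x - ξ + t • (EuclideanSpace.single i (1:ℝ) : V)
        = x + t • (EuclideanSpace.single i (1:ℝ) : V) - ξ := fun t => by abel
    simp_rw [hsub] at d2 d4
    have d2' := d2.add_const e
    have c1 := HasDerivAt.comp (0:ℝ) (h₂ := P) (by rw [e0]; exact hP _) d1
    have c2 := HasDerivAt.comp (0:ℝ) (h₂ := P1) (by rw [e0]; exact hP1 _) d1
    have c3 := HasDerivAt.comp (0:ℝ) (h₂ := a) (by rw [e0]; exact ha _ (Qpos x)) d2'
    have c4 := HasDerivAt.comp (0:ℝ) (h₂ := a1) (by rw [e0]; exact ha1 _ (Qpos x)) d2'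
    have := (((c3.mul c2).mul d3).const_mul 2).sub (((c1.mul c4).mul d4).const_mul 2)
    refine HasDerivAt.congr_deriv this ?_
    simp only [D, Function.comp, Pi.mul_apply, e0]
    ring
  have hsum : ∫ x, ∑ i, D i x = 0 := by
    rw [integral_finsetSum _ (fun i _ => iD i)]; simp [hD]
  have hS : ∀ y : V, ∑ i, (y i) ^ 2 = ‖y‖ ^ 2 := fun y => by
    rw [EuclideanSpace.norm_sq_eq]; simp
  rw [← sub_eq_zero, ← integral_sub, ← hsum]
  · congr 1; funext x
    simp only [D, Finset.sum_sub_distrib, Finset.sum_add_distrib, ← Finset.mul_sum, hS]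
    simp
    ring
  · refine cs _ (cA.mul (((cc _).mul cp1).add (((cc 4).mul cq).mul cp2))) fun x hx => ?_
    simp [z1 _ hx, z2 _ hx]
  · refine cs _ ((((cc _).mul cA1).add (((cc 4).mul (by fun_prop)).mul cA2)).mul cp0) fun x hx => ?_
    simp [z0 _ hx]
end ibp
section ibpsing
open Filter Topology
variable {n : ℕ}
local notation "V" => EuclideanSpace ℝ (Fin n)

lemma ker_mul_integrable (hn : 1 ≤ n) {γ : ℝ} (hγ : -(n:ℝ) < γ) (hγ0 : γ < 0)
    {ψ : V → ℝ} (hψ : Continuous ψ) (hψc : HasCompactSupport ψ) (ξ : V) :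
    Integrable (fun x => ‖x - ξ‖ ^ γ * ψ x) := by
  have hψi : Integrable ψ := hψ.integrable_of_hasCompactSupport hψc
  obtain ⟨B, hB⟩ := hψ.bounded_above_of_compact_support hψc
  refine ((intM hγ0 one_pos hψi ξ).add (intH hn hγ one_pos hψi hB ξ)).congr (ae_of_all _ fun x => ?_)
  simp only [Pi.add_apply, kerH, norm_sub_rev ξ x]
  ring

lemma compact_rad (g : ℝ → ℝ) (L : ℝ) (z : ∀ s, L ≤ s → g s = 0) :
    HasCompactSupport (fun x : V => g (‖x‖ ^ 2)) := by
  refine HasCompactSupport.intro (isCompact_closedBall (0:V) (|L| + 1)) fun x hx => z _ ?_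
  have : |L| + 1 < ‖x‖ := by simpa using hx
  nlinarith [le_abs_self L, abs_nonneg L]

lemma ibp_sing (hn : 1 ≤ n) (P P1 P2 : ℝ → ℝ) (hP : ∀ s, HasDerivAt P (P1 s) s)
    (hP1 : ∀ s, HasDerivAt P1 (P2 s) s)
    (hP2 : Continuous P2) (L : ℝ) (z0 : ∀ s, L ≤ s → P s = 0) (z1 : ∀ s, L ≤ s → P1 s = 0)
    (z2 : ∀ s, L ≤ s → P2 s = 0) (p : ℝ) (hp : p < 0) (hpn : -(n:ℝ) < p - 2) (ξ : V) :
    ∫ x : V, ‖x - ξ‖ ^ p * (2 * n * P1 (‖x‖ ^ 2) + 4 * ‖x‖ ^ 2 * P2 (‖x‖ ^ 2)) =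
    p * (n + p - 2) * ∫ x : V, ‖x - ξ‖ ^ (p - 2) * P (‖x‖ ^ 2) := by
  have : Nonempty (Fin n) := ⟨⟨0, hn⟩⟩
  have cP : Continuous P := continuous_iff_continuousAt.2 fun s => (hP s).continuousAt
  have cP1 : Continuous P1 := continuous_iff_continuousAt.2 fun s => (hP1 s).continuousAt
  have cq : Continuous fun x : V => ‖x‖ ^ 2 := by fun_prop
  set W : V → ℝ := fun x => 2 * n * P1 (‖x‖ ^ 2) + 4 * ‖x‖ ^ 2 * P2 (‖x‖ ^ 2) with hW
  have cW : Continuous W := by fun_prop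
  have cPq : Continuous fun x : V => P (‖x‖ ^ 2) := cP.comp cq
  have sW : HasCompactSupport W :=
    compact_rad (fun s => 2 * n * P1 s + 4 * s * P2 s) L fun s hs => by simp [z1 s hs, z2 s hs]
  have sP : HasCompactSupport fun x : V => P (‖x‖ ^ 2) := compact_rad P L z0
  have iW := ker_mul_integrable hn (by linarith) hp cW sW ξ
  have iP := ker_mul_integrable hn hpn (by linarith) cPq sP ξ
  have hne : ∀ᵐ x : V, x ≠ ξ := compl_mem_ae_iff.2 (measure_singleton ξ)
  have hsq : ∀ (y : V) (c : ℝ), (‖y‖ ^ 2) ^ (c / 2) = ‖y‖ ^ c := fun y c => by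
    rw [← Real.rpow_natCast, ← Real.rpow_mul (norm_nonneg _)]; congr 1; push_cast; ring
  have key : ∀ e : ℝ, 0 < e → ∫ x : V, (‖x - ξ‖ ^ 2 + e) ^ (p/2) * W x =
      ∫ x : V, (2 * n * ((p/2) * (‖x - ξ‖ ^ 2 + e) ^ (p/2 - 1)) + 4 * ‖x - ξ‖ ^ 2 *
        ((p/2) * ((p/2 - 1) * (‖x - ξ‖ ^ 2 + e) ^ (p/2 - 1 - 1)))) * P (‖x‖ ^ 2) := by
    intro e he
    refine ibp P P1 P2 hP hP1 hP2 L z0 z1 z2 (fun s => s ^ (p/2)) (fun s => (p/2) * s ^ (p/2 - 1))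
      (fun s => (p/2) * ((p/2 - 1) * s ^ (p/2 - 1 - 1))) ?_ ?_ ?_ ξ e he
    · intro s hs
      exact Real.hasDerivAt_rpow_const (Or.inl hs.ne')
    · intro s hs
      exact (Real.hasDerivAt_rpow_const (Or.inl hs.ne')).const_mul _
    · intro s hs
      exact (continuousAt_const.mul (continuousAt_const.mul
        (Real.continuousAt_rpow_const _ _ (Or.inl (ne_of_gt hs))))).continuousWithinAt
  have rpc : ∀ (c : ℝ) (x : V), x ≠ ξ →
      Tendsto (fun e : ℝ => (‖x - ξ‖ ^ 2 + e) ^ c) (𝓝[>] 0) (𝓝 ((‖x - ξ‖ ^ 2) ^ c)) := by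
    intro c x hx
    have h0 : ‖x - ξ‖ ^ 2 ≠ 0 := by simpa [sub_eq_zero] using hx
    have h1 : Tendsto (fun e : ℝ => ‖x - ξ‖ ^ 2 + e) (𝓝[>] 0) (𝓝 (‖x - ξ‖ ^ 2)) := by
      have : Continuous fun e : ℝ => ‖x - ξ‖ ^ 2 + e := by fun_prop
      have h := this.tendsto 0
      rw [add_zero] at h
      exact h.mono_left nhdsWithin_le_nhds
    exact h1.rpow_const (Or.inl h0)
  have cQ : ∀ e > 0, ∀ c : ℝ, Continuous fun x : V => (‖x - ξ‖ ^ 2 + e) ^ c := fun e he c =>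
    Continuous.rpow_const (by fun_prop) fun x => Or.inl (by positivity)
  have lim1 : Tendsto (fun e : ℝ => ∫ x : V, (‖x - ξ‖ ^ 2 + e) ^ (p/2) * W x) (𝓝[>] 0)
      (𝓝 (∫ x : V, ‖x - ξ‖ ^ p * W x)) := by
    refine tendsto_integral_filter_of_dominated_convergence (fun x => ‖‖x - ξ‖ ^ p * W x‖) ?_ ?_ iW.norm ?_
    · filter_upwards [self_mem_nhdsWithin] with e he
      exact ((cQ e he _).mul cW).aestronglyMeasurable
    · filter_upwards [self_mem_nhdsWithin] with e he
      filter_upwards [hne] with x hx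
      have h0 : 0 < ‖x - ξ‖ := by simpa [sub_eq_zero] using hx
      have he : 0 < e := he
      rw [norm_mul, norm_mul, Real.norm_of_nonneg (r := (‖x - ξ‖ ^ 2 + e) ^ (p/2)) (by positivity),
        Real.norm_of_nonneg (r := ‖x - ξ‖ ^ p) (by positivity), ← hsq]
      refine mul_le_mul_of_nonneg_right ?_ (norm_nonneg _)
      exact Real.rpow_le_rpow_of_nonpos (by positivity) (by linarith) (by linarith)
    · filter_upwards [hne] with x hx
      rw [← hsq]
      exact (rpc _ x hx).mul_const _
  have lim2 : Tendsto (fun e : ℝ => ∫ x : V, (2 * n * ((p/2) * (‖x - ξ‖ ^ 2 + e) ^ (p/2 - 1)) + 4 * ‖x - ξ‖ ^ 2 *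
        ((p/2) * ((p/2 - 1) * (‖x - ξ‖ ^ 2 + e) ^ (p/2 - 1 - 1)))) * P (‖x‖ ^ 2)) (𝓝[>] 0)
      (𝓝 (∫ x : V, p * (n + p - 2) * (‖x - ξ‖ ^ (p - 2) * P (‖x‖ ^ 2)))) := by
    refine tendsto_integral_filter_of_dominated_convergence
      (fun x => (n * |p| + |p| * |p - 2|) * ‖‖x - ξ‖ ^ (p - 2) * P (‖x‖ ^ 2)‖) ?_ ?_ (iP.norm.const_mul _) ?_
    · filter_upwards [self_mem_nhdsWithin] with e he
      refine Continuous.aestronglyMeasurable ?_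
      have := cQ e he (p/2 - 1)
      have := cQ e he (p/2 - 1 - 1)
      fun_prop
    · filter_upwards [self_mem_nhdsWithin] with e he
      filter_upwards [hne] with x hx
      have h0 : 0 < ‖x - ξ‖ := by simpa [sub_eq_zero] using hx
      have he : 0 < e := he
      rw [norm_mul, norm_mul, ← mul_assoc ((n:ℝ) * |p| + |p| * |p - 2|)]
      refine mul_le_mul_of_nonneg_right ?_ (norm_nonneg _)
      set s := ‖x - ξ‖ ^ 2 + e with hs
      have hspos : 0 < s := by positivity
      have b1 : s ^ (p/2 - 1) ≤ ‖x - ξ‖ ^ (p - 2) := by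
        rw [← hsq, show (p - 2)/2 = p/2 - 1 by ring]
        exact Real.rpow_le_rpow_of_nonpos (by positivity) (by linarith) (by linarith)
      have b2 : ‖x - ξ‖ ^ 2 * s ^ (p/2 - 1 - 1) ≤ s ^ (p/2 - 1) := by
        calc ‖x - ξ‖ ^ 2 * s ^ (p/2 - 1 - 1) ≤ s * s ^ (p/2 - 1 - 1) := by gcongr; linarith
          _ = s ^ (p/2 - 1) := by
            rw [Real.rpow_sub_one hspos.ne' (p/2-1)]; field_simp
      rw [Real.norm_of_nonneg (r := ‖x - ξ‖ ^ (p - 2)) (by positivity)]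
      have e1 : 2 * n * ((p/2) * s ^ (p/2 - 1)) + 4 * ‖x - ξ‖ ^ 2 *
        ((p/2) * ((p/2 - 1) * s ^ (p/2 - 1 - 1))) = n * p * s ^ (p/2 - 1) +
          p * (p - 2) * (‖x - ξ‖ ^ 2 * s ^ (p/2 - 1 - 1)) := by ring
      rw [e1]
      refine (norm_add_le _ _).trans ?_
      have n1 : 0 ≤ ‖x - ξ‖ ^ 2 * s ^ (p/2 - 1 - 1) := by positivity
      have n2 : 0 ≤ s ^ (p/2 - 1) := by positivity
      rw [norm_mul, norm_mul (p * (p-2)), Real.norm_of_nonneg n1, Real.norm_of_nonneg n2, norm_mul, norm_mul,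
        Real.norm_natCast, Real.norm_eq_abs, Real.norm_eq_abs, add_mul]
      gcongr
      exact b2.trans b1
    · filter_upwards [hne] with x hx
      have h0 : 0 < ‖x - ξ‖ := by simpa [sub_eq_zero] using hx
      have t1 := rpc (p/2 - 1) x hx
      have t2 := rpc (p/2 - 1 - 1) x hx
      have := ((((t1.const_mul (p/2)).const_mul (2 * (n:ℝ))).add
        (((t2.const_mul (p/2-1)).const_mul (p/2)).const_mul (4 * ‖x - ξ‖ ^ 2)))).mul_const (P (‖x‖ ^ 2))
      convert this using 2
      rw [Real.rpow_sub_one (by positivity) (p/2-1), ← hsq, show (p - 2)/2 = p/2 - 1 by ring]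
      field_simp
      ring
  have lim3 := lim1.congr' (by filter_upwards [self_mem_nhdsWithin] with e he using key e he)
  have := tendsto_nhds_unique lim3 lim2
  rw [this, integral_const_mul]
end ibpsing
section testfn
open Filter Topology
variable {n : ℕ}
local notation "V" => EuclideanSpace ℝ (Fin n)

lemma cont_mul_rpow (g : ℝ → ℝ) (hg : Continuous g) {ρ : ℝ} (hρ : 0 < ρ) (z : ∀ s, s ≤ ρ → g s = 0)
    (c : ℝ) : Continuous fun s => s ^ c * g s := by
  rw [continuous_iff_continuousAt]
  intro s
  rcases lt_or_ge s ρ with h | h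
  · have : (fun s => s ^ c * g s) =ᶠ[𝓝 s] fun _ => 0 := by
      filter_upwards [Iio_mem_nhds h] with t ht
      rw [z t (le_of_lt ht), mul_zero]
    exact continuousAt_const.congr this.symm
  · exact (Real.continuousAt_rpow_const _ _ (Or.inl (by linarith))).mul hg.continuousAt

lemma testfn (m : ℝ) (A A1 : ℝ → ℝ) (hA : ∀ s, HasDerivAt A (A1 s) s) (cA1 : Continuous A1)
    {ρ L : ℝ} (hρ : 0 < ρ) (zA : ∀ s, s ≤ ρ → A s = 0) (zA1 : ∀ s, s ≤ ρ → A1 s = 0)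
    (yA : ∀ s, L ≤ s → A s = 0) (yA1 : ∀ s, L ≤ s → A1 s = 0) (hpos : ∀ s, 0 ≤ A s) :
    ∃ P P1 P2 : ℝ → ℝ, (∀ s, HasDerivAt P (P1 s) s) ∧ (∀ s, HasDerivAt P1 (P2 s) s) ∧
      Continuous P2 ∧ (∀ s, L ≤ s → P s = 0) ∧ (∀ s, L ≤ s → P1 s = 0) ∧ (∀ s, L ≤ s → P2 s = 0) ∧
      (∀ s, 0 ≤ P s) ∧ ∀ s, 4 * m * P1 s + 4 * s * P2 s = -4 * (s ^ (1 - m) * A1 s) := by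
  have cA : Continuous A := continuous_iff_continuousAt.2 fun s => (hA s).continuousAt
  have cB := cont_mul_rpow A cA hρ zA (-m)
  have hBpos : ∀ s, 0 ≤ s ^ (-m) * A s := by
    intro s
    rcases le_or_gt s ρ with h | h
    · simp [zA s h]
    · have : 0 < s := hρ.trans h
      exact mul_nonneg (by positivity) (hpos s)
  refine ⟨fun s => -∫ t in L..s, t ^ (-m) * A t, fun s => -(s ^ (-m) * A s),
    fun s => m * (s ^ (-m - 1) * A s) - s ^ (-m) * A1 s, ?_, ?_, ?_, ?_, ?_, ?_, ?_, ?_⟩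
  · intro s
    exact (cB.integral_hasStrictDerivAt L s).hasDerivAt.neg
  · intro s
    rcases lt_or_ge s ρ with h | h
    · have h1 : (fun s => -(s ^ (-m) * A s)) =ᶠ[𝓝 s] fun _ => 0 := by
        filter_upwards [Iio_mem_nhds h] with t ht
        rw [zA t (le_of_lt ht), mul_zero, neg_zero]
      refine ((hasDerivAt_const s (0:ℝ)).congr_of_eventuallyEq h1).congr_deriv ?_
      simp [zA s h.le, zA1 s h.le]
    · have h0 : 0 < s := by linarith
      have := ((Real.hasDerivAt_rpow_const (p := -m) (Or.inl h0.ne')).mul (hA s)).neg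
      refine this.congr_deriv ?_
      ring
  · exact ((cont_mul_rpow A cA hρ zA _).const_mul m).sub (cont_mul_rpow A1 cA1 hρ zA1 _)
  · intro s hs
    have : ∫ t in L..s, t ^ (-m) * A t = ∫ t in L..s, (0:ℝ) := by
      refine intervalIntegral.integral_congr fun t ht => ?_
      rw [uIcc_of_le hs] at ht
      simp [yA t ht.1]
    simp [this]
  · intro s hs; simp [yA s hs]
  · intro s hs; simp [yA s hs, yA1 s hs]
  · intro s
    show 0 ≤ -∫ t in L..s, t ^ (-m) * A t
    rcases le_or_gt L s with h | h
    · have : ∫ t in L..s, t ^ (-m) * A t = ∫ t in L..s, (0:ℝ) := by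
        refine intervalIntegral.integral_congr fun t ht => ?_
        rw [uIcc_of_le h] at ht
        simp [yA t ht.1]
      simp [this]
    · rw [← intervalIntegral.integral_symm]
      exact intervalIntegral.integral_nonneg h.le fun t _ => hBpos t
  · intro s
    rcases le_or_gt s ρ with h | h
    · simp [zA s h, zA1 s h]
    · have h0 : 0 < s := hρ.trans h
      simp only
      rw [Real.rpow_sub_one h0.ne', show (1 - m) = -m + 1 by ring, Real.rpow_add_one h0.ne']
      field_simp
      ring

lemma chi_deriv_nonpos {x : ℝ} (hx : x ≤ 0) : deriv Real.smoothTransition x = 0 := by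
  refine IsLocalMin.deriv_eq_zero (Eventually.of_forall fun y => ?_)
  rw [Real.smoothTransition.zero_of_nonpos hx]
  exact Real.smoothTransition.nonneg y

lemma chi_deriv_ge_one {x : ℝ} (hx : 1 ≤ x) : deriv Real.smoothTransition x = 0 := by
  refine IsLocalMax.deriv_eq_zero (Eventually.of_forall fun y => ?_)
  rw [Real.smoothTransition.one_of_one_le hx]
  exact Real.smoothTransition.le_one y

lemma chi_diff : Differentiable ℝ Real.smoothTransition :=
  (Real.smoothTransition.contDiff (n := 1)).differentiable (by simp)

lemma chi_deriv_cont : Continuous (deriv Real.smoothTransition) :=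
  (Real.smoothTransition.contDiff (n := 1)).continuous_deriv (by simp)

lemma chi_deriv_nonneg (x : ℝ) : 0 ≤ deriv Real.smoothTransition x :=
  Real.smoothTransition.monotone.deriv_nonneg

lemma chi_deriv_pos : ∃ t ∈ Ioo (0:ℝ) 1, 0 < deriv Real.smoothTransition t := by
  obtain ⟨c, hc, h⟩ := exists_deriv_eq_slope Real.smoothTransition (zero_lt_one' ℝ)
    chi_diff.continuous.continuousOn chi_diff.differentiableOn
  refine ⟨c, hc, ?_⟩
  rw [h, Real.smoothTransition.zero_of_nonpos le_rfl, Real.smoothTransition.one_of_one_le le_rfl]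
  norm_num

/-- Radial bump adapted to the sphere of radius `r`. -/
noncomputable def bmp (n : ℕ) (δ r s : ℝ) : ℝ :=
  s ^ (1 - (n:ℝ)/2) * (deriv Real.smoothTransition ((s - r ^ 2) / δ) / δ)

lemma bmp_cont {δ r : ℝ} (hδ : 0 < δ) (hr : 0 < r) : Continuous (bmp n δ r) := by
  refine cont_mul_rpow (fun s => deriv Real.smoothTransition ((s - r ^ 2) / δ) / δ) ?_
    (ρ := r ^ 2) (by positivity) ?_ _
  · have := chi_deriv_cont
    fun_prop
  · intro s hs
    rw [chi_deriv_nonpos (div_nonpos_of_nonpos_of_nonneg (by linarith) hδ.le), zero_div]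

lemma bmp_zero {δ r s : ℝ} (hδ : 0 < δ) (hs : ¬ (r ^ 2 ≤ s ∧ s ≤ r ^ 2 + δ)) : bmp n δ r s = 0 := by
  rw [not_and_or, not_le, not_le] at hs
  rw [bmp]
  rcases hs with h | h
  · rw [chi_deriv_nonpos (div_nonpos_of_nonpos_of_nonneg (by linarith) hδ.le), zero_div, mul_zero]
  · rw [chi_deriv_ge_one ((one_le_div hδ).2 (by linarith)), zero_div, mul_zero]

lemma bmp_nonneg {δ r s : ℝ} (hδ : 0 < δ) (hs : 0 ≤ s) : 0 ≤ bmp n δ r s :=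
  mul_nonneg (by positivity) (div_nonneg (chi_deriv_nonneg _) hδ.le)

lemma bmp_compact {δ r : ℝ} (hδ : 0 < δ) : HasCompactSupport fun x : V => bmp n δ r (‖x‖ ^ 2) :=
  compact_rad (bmp n δ r) (r ^ 2 + δ + 1) fun s hs => bmp_zero hδ (by intro h; linarith [h.2])

lemma bmp_cont' {δ r : ℝ} (hδ : 0 < δ) (hr : 0 < r) : Continuous fun x : V => bmp n δ r (‖x‖ ^ 2) :=
  (bmp_cont hδ hr).comp (by fun_prop)

lemma bmp_pos (hn : 1 ≤ n) {δ r : ℝ} (hδ : 0 < δ) (hr : 0 < r) :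
    0 < ∫ x : V, bmp n δ r (‖x‖ ^ 2) := by
  obtain ⟨t, ht, h⟩ := chi_deriv_pos
  have hq : 0 < r ^ 2 + δ * t := by have := mul_pos hδ ht.1; positivity
  refine (bmp_cont' hδ hr).integral_pos_of_hasCompactSupport_nonneg_nonzero (bmp_compact hδ)
    (fun x => bmp_nonneg hδ (by positivity)) (x := EuclideanSpace.single ⟨0, hn⟩ (√(r ^ 2 + δ * t))) ?_
  have e : ‖(EuclideanSpace.single (⟨0, hn⟩ : Fin n) (√(r ^ 2 + δ * t)) : V)‖ ^ 2 = r ^ 2 + δ * t := by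
    rw [EuclideanSpace.norm_single, Real.norm_eq_abs, sq_abs, Real.sq_sqrt hq.le]
  rw [e, bmp, show (r ^ 2 + δ * t - r ^ 2) / δ = t by field_simp; ring]
  exact (mul_pos (Real.rpow_pos_of_pos hq _) (div_pos h hδ)).ne'

lemma test_exists {δ r R : ℝ} (hδ : 0 < δ) (hr : 0 < r) (hrR : r < R) :
    ∃ P P1 P2 : ℝ → ℝ, ∃ L : ℝ, (∀ s, HasDerivAt P (P1 s) s) ∧ (∀ s, HasDerivAt P1 (P2 s) s) ∧
      Continuous P2 ∧ (∀ s, L ≤ s → P s = 0) ∧ (∀ s, L ≤ s → P1 s = 0) ∧ (∀ s, L ≤ s → P2 s = 0) ∧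
      (∀ s, 0 ≤ P s) ∧ ∀ s, 2 * n * P1 s + 4 * s * P2 s = 4 * (bmp n δ R s - bmp n δ r s) := by
  have hsq : r ^ 2 < R ^ 2 := by nlinarith
  set A : ℝ → ℝ := fun s => Real.smoothTransition ((s - r ^ 2) / δ) - Real.smoothTransition ((s - R ^ 2) / δ)
  set A1 : ℝ → ℝ := fun s => deriv Real.smoothTransition ((s - r ^ 2) / δ) / δ -
    deriv Real.smoothTransition ((s - R ^ 2) / δ) / δ with hA1
  have key := testfn ((n:ℝ)/2) A A1 ?_ ?_
    (ρ := r ^ 2) (L := R ^ 2 + δ) (by positivity) ?_ ?_ ?_ ?_ ?_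
  · obtain ⟨P, P1, P2, h1, h2, h3, h4, h5, h6, h7, h8⟩ := key
    refine ⟨P, P1, P2, _, h1, h2, h3, h4, h5, h6, h7, fun s => ?_⟩
    have := h8 s
    rw [show 4 * ((n:ℝ)/2) = 2 * n by ring] at this
    rw [this, bmp, bmp, hA1]
    ring
  · intro s
    have aux : ∀ c : ℝ, HasDerivAt (fun s => Real.smoothTransition ((s - c) / δ))
        (deriv Real.smoothTransition ((s - c) / δ) / δ) s := by
      intro c
      have g1 : HasDerivAt (fun s : ℝ => (s - c) / δ) (1 / δ) s := ((hasDerivAt_id s).sub_const c).div_const δ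
      have := (chi_diff ((s - c) / δ)).hasDerivAt.comp s g1
      exact this.congr_deriv (by ring)
    exact (aux _).sub (aux _)
  · have := chi_deriv_cont
    fun_prop
  · intro s hs
    simp only [A]
    rw [Real.smoothTransition.zero_of_nonpos (div_nonpos_of_nonpos_of_nonneg (by linarith) hδ.le),
      Real.smoothTransition.zero_of_nonpos (div_nonpos_of_nonpos_of_nonneg (by linarith) hδ.le), sub_zero]
  · intro s hs
    simp only [A1]
    rw [chi_deriv_nonpos (div_nonpos_of_nonpos_of_nonneg (by linarith) hδ.le),
      chi_deriv_nonpos (div_nonpos_of_nonpos_of_nonneg (by linarith) hδ.le), sub_self]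
  · intro s hs
    simp only [A]
    rw [Real.smoothTransition.one_of_one_le ((one_le_div hδ).2 (by linarith)),
      Real.smoothTransition.one_of_one_le ((one_le_div hδ).2 (by linarith)), sub_self]
  · intro s hs
    simp only [A1]
    rw [chi_deriv_ge_one ((one_le_div hδ).2 (by linarith)),
      chi_deriv_ge_one ((one_le_div hδ).2 (by linarith)), sub_self]
  · intro s
    simp only [A, sub_nonneg]
    exact Real.smoothTransition.monotone (by gcongr)

end testfn
section assembly
open Filter Topology
variable {n : ℕ}
local notation "V" => EuclideanSpace ℝ (Fin n)

lemma rc_pos {β : ℝ} (h0 : 0 < β) (h1 : β < n) : 0 < rieszConst n β := by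
  have := Real.Gamma_pos_of_pos (half_pos h0)
  have := Real.Gamma_pos_of_pos (half_pos (sub_pos.2 h1))
  have := Real.pi_pos
  rw [rieszConst]
  positivity

lemma riesz_cont (hn : 1 ≤ n) {β : ℝ} (h0 : 0 < β) (h1 : β < n)
    {f : V → ℝ} (hf : Integrable f) {M : ℝ} (hM0 : 0 < M) (hM : ∀ x, |f x| ≤ M) :
    Continuous (rieszPot β f) :=
  (pot_cont hn (by linarith) (by linarith) hf hM0 hM).const_mul _

lemma riesz_bdd (hn : 1 ≤ n) {β : ℝ} (h0 : 0 < β) (h1 : β < n)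
    {f : V → ℝ} (hf : Integrable f) {M : ℝ} (hM0 : 0 < M) (hM : ∀ x, |f x| ≤ M) :
    ∃ C, ∀ x, |rieszPot β f x| ≤ C := by
  obtain ⟨C, hC⟩ := pot_bdd hn (γ := β - n) (by linarith) (by linarith) hf hM0 hM
  refine ⟨|rieszConst n β| * C, fun x => ?_⟩
  rw [rieszPot, abs_mul]
  exact mul_le_mul_of_nonneg_left (hC x) (abs_nonneg _)

lemma riesz_decay (hn : 1 ≤ n) {β : ℝ} (h0 : 0 < β) (h1 : β < n)
    {f : V → ℝ} (hf : Integrable f) {M : ℝ} (hM0 : 0 < M) (hM : ∀ x, |f x| ≤ M) :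
    Tendsto (rieszPot β f) (cocompact V) (𝓝 0) := by
  have h := (pot_decay hn (γ := β - n) (by linarith) (by linarith) hf hM0 hM).const_mul (rieszConst n β)
  rw [mul_zero] at h
  exact h

lemma avg_const (hn : 1 ≤ n) (hok : SphOK n) (c : ℝ) {r : ℝ} (hr : 0 < r) :
    sphAvg (fun _ : V => c) r = c := by
  have h := sphAvg_eq hn hok (fun _ : V => c) continuous_const |c| (fun _ => le_rfl) hr
  rw [integral_const, smul_eq_mul] at h
  exact (mul_left_cancel₀ (sphMass_pos hn).ne' h).symm

lemma avg_cont (hn : 1 ≤ n) (hok : SphOK n) (g : V → ℝ) (hg : Continuous g) (C : ℝ)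
    (hC : ∀ x, |g x| ≤ C) : ContinuousOn (sphAvg g) (Ioi 0) := by
  have h : Continuous fun r : ℝ => (sphMass n)⁻¹ *
      ∫ ω : sphere (0:V) 1, g (r • (ω:V)) ∂(volume : Measure V).toSphere := by
    refine Continuous.const_mul ?_ _
    refine continuous_of_dominated (bound := fun _ => C) (fun r => ?_) (fun r => ae_of_all _ fun ω => hC _)
      (integrable_const _) (ae_of_all _ fun ω => ?_)
    · exact (hg.comp (by fun_prop)).aestronglyMeasurable
    · exact hg.comp (by fun_prop)
  refine h.continuousOn.congr fun r hr => ?_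
  simp only
  rw [sphAvg_eq hn hok g hg C hC hr, inv_mul_cancel_left₀ (sphMass_pos hn).ne']

lemma avg_decay (hn : 1 ≤ n) (hok : SphOK n) (g : V → ℝ) (hg : Continuous g) (C : ℝ)
    (hC : ∀ x, |g x| ≤ C) (hd : Tendsto g (cocompact V) (𝓝 0)) {ε : ℝ} (hε : 0 < ε) :
    ∃ T : ℝ, ∀ r, 0 < r → T < r → |sphAvg g r| ≤ ε := by
  have h := Metric.tendsto_nhds.1 hd ε hε
  rw [← Metric.cobounded_eq_cocompact, ← comap_norm_atTop, eventually_comap] at h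
  obtain ⟨T, hT⟩ := eventually_atTop.1 h
  refine ⟨T, fun r hr hTr => ?_⟩
  have h1 : ‖∫ ω : sphere (0:V) 1, g (r • (ω:V)) ∂(volume : Measure V).toSphere‖ ≤ ε * sphMass n := by
    refine norm_integral_le_of_norm_le_const (ae_of_all _ fun ω => ?_)
    have := hT r hTr.le (r • (ω:V)) (by simp [norm_smul, abs_of_pos hr])
    rw [dist_zero_right] at this
    exact this.le
  have hp := sphMass_pos hn
  rw [sphAvg_eq hn hok g hg C hC hr, norm_mul, Real.norm_of_nonneg hp.le, mul_comm] at h1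
  exact le_of_mul_le_mul_right h1 hp

lemma avg_nonneg (hn : 1 ≤ n) (hok : SphOK n) (g : V → ℝ) (hg : Continuous g) (C : ℝ)
    (hC : ∀ x, |g x| ≤ C) (hd : Tendsto g (cocompact V) (𝓝 0)) (ha : AntitoneOn (sphAvg g) (Ioi 0))
    {r : ℝ} (hr : 0 < r) : 0 ≤ sphAvg g r := by
  by_contra! h
  obtain ⟨T, hT⟩ := avg_decay hn hok g hg C hC hd (ε := -sphAvg g r / 2) (by linarith)
  have hs : 0 < max r T + 1 := by have := le_max_left r T; linarith
  have h1 := hT (max r T + 1) hs (by have := le_max_right r T; linarith)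
  have h2 := ha hr hs (by have := le_max_left r T; linarith)
  have := (abs_le.1 h1).1
  linarith

lemma int_mono (hn : 1 ≤ n) (hok : SphOK n) (g1 g2 : V → ℝ) (hg1 : Continuous g1) (hg2 : Continuous g2)
    (C1 C2 : ℝ) (hC1 : ∀ x, |g1 x| ≤ C1) (hC2 : ∀ x, |g2 x| ≤ C2) (w : ℝ → ℝ)
    (cw : Continuous fun x : V => w (‖x‖ ^ 2)) (sw : HasCompactSupport fun x : V => w (‖x‖ ^ 2))
    (h : ∀ t, 0 < t → sphAvg g1 t * w (t ^ 2) ≤ sphAvg g2 t * w (t ^ 2)) :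
    ∫ x, g1 x * w (‖x‖ ^ 2) ≤ ∫ x, g2 x * w (‖x‖ ^ 2) := by
  have i1 : Integrable fun x : V => g1 x * w (‖x‖ ^ 2) :=
    (hg1.mul cw).integrable_of_hasCompactSupport sw.mul_left
  have i2 : Integrable fun x : V => g2 x * w (‖x‖ ^ 2) :=
    (hg2.mul cw).integrable_of_hasCompactSupport sw.mul_left
  obtain ⟨e1, j1⟩ := polar hn hok g1 hg1 C1 hC1 (fun t => w (t ^ 2)) i1
  obtain ⟨e2, j2⟩ := polar hn hok g2 hg2 C2 hC2 (fun t => w (t ^ 2)) i2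
  rw [e1, e2]
  exact mul_le_mul_of_nonneg_left (integral_mono j1 j2 fun t => h t t.2) (sphMass_pos hn).le

lemma weak_le (hn : 1 ≤ n) (hok : SphOK n) {α : ℝ} (hα0 : 0 < α) (hα : α + 2 < n)
    {f : V → ℝ} (hf : Integrable f) {M : ℝ} (hM0 : 0 < M) (hM : ∀ x, |f x| ≤ M)
    (hmono : AntitoneOn (sphAvg (rieszPot α f)) (Ioi 0))
    {δ r R : ℝ} (hδ : 0 < δ) (hr : 0 < r) (hrR : r < R) :
    ∫ x : V, rieszPot (α + 2) f x * bmp n δ R (‖x‖ ^ 2) ≤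
      ∫ x : V, rieszPot (α + 2) f x * bmp n δ r (‖x‖ ^ 2) ∧
    ∫ x : V, bmp n δ R (‖x‖ ^ 2) = ∫ x : V, bmp n δ r (‖x‖ ^ 2) := by
  obtain ⟨P, P1, P2, L, hP, hP1, hP2, z0, z1, z2, hpos, hW⟩ := test_exists (n := n) hδ hr hrR
  have hR : 0 < R := hr.trans hrR
  have cr := bmp_cont' (n := n) hδ hr
  have cR := bmp_cont' (n := n) hδ hR
  have sr := bmp_compact (n := n) (r := r) hδ
  have sR := bmp_compact (n := n) (r := R) hδ
  constructor
  swap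
  · have h := ibp P P1 P2 hP hP1 hP2 L z0 z1 z2 (fun _ => 1) (fun _ => 0) (fun _ => 0)
      (fun s _ => hasDerivAt_const s 1) (fun s _ => hasDerivAt_const s 0) continuousOn_const
      (0 : V) 1 one_pos
    simp only [one_mul, mul_zero, add_zero, zero_mul, integral_zero, hW] at h
    rw [integral_const_mul, integral_sub (cR.integrable_of_hasCompactSupport sR)
      (cr.integrable_of_hasCompactSupport sr)] at h
    linarith
  have cP : Continuous P := continuous_iff_continuousAt.2 fun s => (hP s).continuousAt
  have cP1 : Continuous P1 := continuous_iff_continuousAt.2 fun s => (hP1 s).continuousAt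
  have cPq : Continuous fun x : V => P (‖x‖ ^ 2) := cP.comp (by fun_prop)
  have sP : HasCompactSupport fun x : V => P (‖x‖ ^ 2) := compact_rad P L z0
  have cW : Continuous fun x : V => 2 * n * P1 (‖x‖ ^ 2) + 4 * ‖x‖ ^ 2 * P2 (‖x‖ ^ 2) := by fun_prop
  have sW : HasCompactSupport fun x : V => 2 * n * P1 (‖x‖ ^ 2) + 4 * ‖x‖ ^ 2 * P2 (‖x‖ ^ 2) :=
    compact_rad (fun s => 2 * n * P1 s + 4 * s * P2 s) L fun s hs => by simp [z1 s hs, z2 s hs]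
  have c2 := riesz_cont hn (β := α + 2) (by linarith) hα hf hM0 hM
  have c1 := riesz_cont hn hα0 (by linarith) hf hM0 hM
  obtain ⟨C, hC⟩ := riesz_bdd hn hα0 (by linarith) hf hM0 hM
  have hnn : 0 ≤ ∫ x : V, rieszPot α f x * P (‖x‖ ^ 2) := by
    have := int_mono hn hok (fun _ => 0) (rieszPot α f) continuous_const c1 0 C (by simp) hC P cPq sP ?_
    · simpa using this
    · intro t ht
      rw [avg_const hn hok 0 ht, zero_mul]
      exact mul_nonneg (avg_nonneg hn hok _ c1 C hC (riesz_decay hn hα0 (by linarith) hf hM0 hM) hmono ht)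
        (hpos _)
  have e2 := pot_fubini hn (γ := α - n) (by linarith) (by linarith) hf cPq sP
  have e1 := pot_fubini hn (γ := α + 2 - n) (by linarith) (by linarith) hf cW sW
  have e3 : ∀ ξ : V, ∫ x : V, ‖x - ξ‖ ^ (α + 2 - n) *
      (2 * n * P1 (‖x‖ ^ 2) + 4 * ‖x‖ ^ 2 * P2 (‖x‖ ^ 2)) =
      (α + 2 - n) * α * ∫ x : V, ‖x - ξ‖ ^ (α - n) * P (‖x‖ ^ 2) := by
    intro ξ
    rw [ibp_sing hn P P1 P2 hP hP1 hP2 L z0 z1 z2 (α + 2 - n) (by linarith) (by linarith) ξ,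
      show (n:ℝ) + (α + 2 - n) - 2 = α by ring, show α + 2 - (n:ℝ) - 2 = α - n by ring]
  have e4 : ∫ x : V, rieszPot (α + 2) f x * (2 * n * P1 (‖x‖ ^ 2) + 4 * ‖x‖ ^ 2 * P2 (‖x‖ ^ 2)) =
      rieszConst n (α + 2) * ((α + 2 - n) * α * ∫ ξ, f ξ * ∫ x, ‖x - ξ‖ ^ (α - n) * P (‖x‖ ^ 2)) := by
    simp only [rieszPot, mul_assoc (rieszConst n (α + 2))]
    rw [integral_const_mul, e1, ← integral_const_mul ((α + 2 - n) * α)]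
    refine congrArg _ ?_
    refine integral_congr_ae (ae_of_all _ fun ξ => ?_)
    simp only [e3]
    ring
  have p1 := rc_pos (n := n) hα0 (by linarith)
  have p2 := rc_pos (n := n) (β := α + 2) (by linarith) hα
  have e5 : ∫ x : V, rieszPot α f x * P (‖x‖ ^ 2) =
      rieszConst n α * ∫ ξ, f ξ * ∫ x, ‖x - ξ‖ ^ (α - n) * P (‖x‖ ^ 2) := by
    simp only [rieszPot, mul_assoc (rieszConst n α)]
    rw [integral_const_mul, e2]
  rw [e5] at hnn
  have hnn' := nonneg_of_mul_nonneg_right hnn p1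
  have hle : ∫ x : V, rieszPot (α + 2) f x * (2 * n * P1 (‖x‖ ^ 2) + 4 * ‖x‖ ^ 2 * P2 (‖x‖ ^ 2)) ≤ 0 := by
    rw [e4]
    refine mul_nonpos_of_nonneg_of_nonpos p2.le (mul_nonpos_of_nonpos_of_nonneg ?_ hnn')
    exact mul_nonpos_of_nonpos_of_nonneg (by linarith) hα0.le
  have i1 : Integrable fun x : V => rieszPot (α + 2) f x * bmp n δ R (‖x‖ ^ 2) :=
    (c2.mul cR).integrable_of_hasCompactSupport sR.mul_left
  have i2 : Integrable fun x : V => rieszPot (α + 2) f x * bmp n δ r (‖x‖ ^ 2) :=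
    (c2.mul cr).integrable_of_hasCompactSupport sr.mul_left
  have e6 : ∫ x : V, rieszPot (α + 2) f x * (2 * n * P1 (‖x‖ ^ 2) + 4 * ‖x‖ ^ 2 * P2 (‖x‖ ^ 2)) =
      4 * ((∫ x : V, rieszPot (α + 2) f x * bmp n δ R (‖x‖ ^ 2)) -
        ∫ x : V, rieszPot (α + 2) f x * bmp n δ r (‖x‖ ^ 2)) := by
    rw [← integral_sub i1 i2, ← integral_const_mul]
    refine integral_congr_ae (ae_of_all _ fun x => ?_)
    simp only [hW]
    ring
  rw [e6] at hle
  linarith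

lemma main_lemma (hn : 1 ≤ n) {α : ℝ} (hα0 : 0 < α) (hα : α + 2 < n)
    {f : V → ℝ} (hf : Integrable f) {M : ℝ} (hM0 : 0 < M) (hM : ∀ x, |f x| ≤ M)
    (hmono : AntitoneOn (sphAvg (rieszPot α f)) (Ioi 0)) :
    AntitoneOn (sphAvg (rieszPot (α + 2) f)) (Ioi 0) := by
  by_cases hok : SphOK n
  swap
  · intro r hr R hR _
    rw [sphAvg_not_ok hn hok _ hr, sphAvg_not_ok hn hok _ hR]
  intro r hr R hR hle
  by_contra! hlt
  have hr : 0 < r := hr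
  have hR : 0 < R := hR
  have hrR : r < R := lt_of_le_of_ne hle (by rintro rfl; exact lt_irrefl _ hlt)
  have cu := riesz_cont hn (β := α + 2) (by linarith) hα hf hM0 hM
  obtain ⟨C, hC⟩ := riesz_bdd hn (β := α + 2) (by linarith) hα hf hM0 hM
  have hc := avg_cont hn hok _ cu C hC
  obtain ⟨c1, hc1, hc1'⟩ := exists_between hlt
  obtain ⟨c2, hc2, hc2'⟩ := exists_between hc1'
  have n1 := (hc.continuousAt (Ioi_mem_nhds hr)).eventually (Iio_mem_nhds hc1)
  have n2 := (hc.continuousAt (Ioi_mem_nhds hR)).eventually (Ioi_mem_nhds hc2')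
  obtain ⟨d1, hd1, h1⟩ := Metric.eventually_nhds_iff.1 n1
  obtain ⟨d2, hd2, h2⟩ := Metric.eventually_nhds_iff.1 n2
  set d := min d1 d2 with hd
  have hd0 : 0 < d := lt_min hd1 hd2
  have hδ : 0 < r * d := mul_pos hr hd0
  have close : ∀ ρ t : ℝ, r ≤ ρ → 0 < t → ρ ^ 2 ≤ t ^ 2 → t ^ 2 ≤ ρ ^ 2 + r * d → dist t ρ < d := by
    intro ρ t hρ ht a b
    have h0 : ρ ≤ t := by nlinarith
    rw [Real.dist_eq, abs_of_nonneg (by linarith)]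
    by_contra! hcon
    nlinarith [mul_le_mul_of_nonneg_right hρ hd0.le, mul_pos (hr.trans_le hρ) hd0]
  obtain ⟨w1, w2⟩ := weak_le hn hok hα0 hα hf hM0 hM hmono hδ hr hrR
  have hM1 := bmp_pos hn hδ hr
  have u1 := int_mono hn hok (rieszPot (α + 2) f) (fun _ => c1) cu continuous_const C |c1| hC (fun _ => le_rfl)
    (bmp n (r * d) r) (bmp_cont' hδ hr) (bmp_compact hδ) ?_
  · have u2 := int_mono hn hok (fun _ => c2) (rieszPot (α + 2) f) continuous_const cu |c2| C (fun _ => le_rfl) hC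
      (bmp n (r * d) R) (bmp_cont' hδ hR) (bmp_compact hδ) ?_
    · rw [integral_const_mul] at u1 u2
      rw [w2] at u2
      nlinarith
    · intro t ht
      rw [avg_const hn hok _ ht]
      by_cases hs : R ^ 2 ≤ t ^ 2 ∧ t ^ 2 ≤ R ^ 2 + r * d
      · refine mul_le_mul_of_nonneg_right ?_ (bmp_nonneg hδ (by positivity))
        exact le_of_lt (h2 ((close R t hle ht hs.1 hs.2).trans_le (min_le_right _ _)))
      · rw [bmp_zero hδ hs, mul_zero, mul_zero]
  · intro t ht
    rw [avg_const hn hok _ ht]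
    by_cases hs : r ^ 2 ≤ t ^ 2 ∧ t ^ 2 ≤ r ^ 2 + r * d
    · refine mul_le_mul_of_nonneg_right ?_ (bmp_nonneg hδ (by positivity))
      exact le_of_lt (h1 ((close r t le_rfl ht hs.1 hs.2).trans_le (min_le_left _ _)))
    · rw [bmp_zero hδ hs, mul_zero, mul_zero]

lemma fE_bound (E : Set V) (x : V) : |fE E x| ≤ 1 := by
  classical
  simp only [fE, indicator_apply, Pi.one_apply]
  split_ifs <;> norm_num

lemma fE_integrable (E : Set V) (hE : MeasurableSet E) (hvol : volume E ≠ ⊤) : Integrable (fE E) :=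
  ((integrable_indicator_iff measurableSet_ball).2 (integrableOn_const (measure_ball_lt_top.ne))).sub
    ((integrable_indicator_iff hE).2 (integrableOn_const hvol))

end assembly

/-- If the spherical averages of `I_α f_E` are nonincreasing, so are those of
`I_{α+2} f_E`. -/
theorem statement9 (n : ℕ) (hn : 5 ≤ n) (α : ℝ) (hα : α ∈ Set.Icc 2 ((n : ℝ) - 3))
    (E : Set (EuclideanSpace ℝ (Fin n))) (hE : HasFinitePerimeter E)
    (hvol : volume E = volume (ball (0 : EuclideanSpace ℝ (Fin n)) 1))
    (hmono : AntitoneOn (sphAvg (rieszPot α (fE E))) (Set.Ioi 0)) :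
    AntitoneOn (sphAvg (rieszPot (α + 2) (fE E))) (Set.Ioi 0) := by
  refine main_lemma (by omega) (by linarith [hα.1]) (by linarith [hα.2])
    (fE_integrable E hE.1 ?_) one_pos (fE_bound E) hmono
  rw [hvol]
  exact measure_ball_lt_top.ne
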